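/- Let M = M(S; F(I), G(Lambda); P) be a finitely generated Rees matrix semigroup without zero over a semigroupoid S (so the sandwich matrix P has no zero entries). If S is prefix-automatic, and the set of non-identity arrows of S is weakly right-ideal-generated by a row cross-section of P, then M is a prefix-automatic semigroup. -/

import Mathlib

/- Common framework: graphs, path languages, synchronous regularity,
   semigroupoids, automatic structures, and Rees matrix constructions. -/

namespace AutoRees

/-- Raw data of a semigroupoid: source and target maps on arrows together with a
totalised multiplication (whose values are only meaningful on composable pairs). -/
structure PreSgpd (O A : Type) where
  src : A → O
  tgt : A → O
  mul : A → A → A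

/-- A semigroupoid: the multiplication respects sources and targets and is
associative, on composable pairs. -/
structure Sgpd (O A : Type) extends PreSgpd O A where
  src_mul : ∀ e f, tgt e = src f → src (mul e f) = src e
  tgt_mul : ∀ e f, tgt e = src f → tgt (mul e f) = tgt f
  mul_assoc' : ∀ e f g, tgt e = src f → tgt f = src g →
    mul (mul e f) g = mul e (mul f g)

/-- Evaluate a nonempty word of edge labels as a product in the semigroupoid
(`none` on the empty word). -/
def evalPath? {O A E : Type} (S : PreSgpd O A) (lab : E → A) : List E → Option A
  | [] => none
  | e :: l => some ((l.map lab).foldl S.mul (lab e))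

/-- The consecutive-compatibility condition making a list of edges a path. -/
def IsPathChain {V E : Type} (esrc etgt : E → V) (l : List E) : Prop :=
  List.Chain' (fun e f => etgt e = esrc f) l

/-- The target of a non-empty path. -/
def pathTgt? {V E : Type} (etgt : E → V) (l : List E) : Option V :=
  l.getLast?.map etgt

/-- The source of a non-empty path. -/
def pathSrc? {V E : Type} (esrc : E → V) (l : List E) : Option V :=
  l.head?.map esrc

/-- A set of words is regular if it is a regular language in the usual sense. -/
def IsRegularSet {α : Type} (L : Set (List α)) : Prop :=
  Language.IsRegular (show Language α from L)

/-- The padding symbol used to pad a pair of paths, at the target of `l`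
(the letters of the padded alphabet `X^$` are `Sum.inl` (a genuine edge) or
`Sum.inr (some v)` (the padding edge at vertex `v`)). -/
def padSym {V E : Type} (etgt : E → V) (l : List E) : E ⊕ Option V :=
  Sum.inr (l.getLast?.map etgt)

/-- The padded convolution `(a, b) δ_X` of a pair of paths. -/
def deltaPair {V E : Type} (etgt : E → V) (a b : List E) :
    List ((E ⊕ Option V) × (E ⊕ Option V)) :=
  (a.map Sum.inl).zip (b.map Sum.inl) ++
    (if a.length ≤ b.length
      then (b.drop a.length).map (fun e => (padSym etgt a, Sum.inl e))
      else (a.drop b.length).map (fun e => (Sum.inl e, padSym etgt b)))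

/-- A binary relation on paths is synchronously regular if its image under the
padding map is a regular language over the padded product alphabet. -/
def SyncRegular {V E : Type} (etgt : E → V) (R : Set (List E × List E)) : Prop :=
  IsRegularSet { w | ∃ p ∈ R, w = deltaPair etgt p.1 p.2 }

/-- A choice of representatives `(X, K, ρ)` for a semigroupoid `S`: a graph `X`
with vertex set `S^0` (edge set `E`, source `esrc`, target `etgt`), a semigroupoid
morphism `ρ : X^+ → S` (induced by the edge-labelling `lab`), and a language `K`
of non-empty paths with `K ρ = S^1`. -/
structure ChoiceOfReps {O A : Type} (S : PreSgpd O A) (E : Type) where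
  esrc : E → O
  etgt : E → O
  lab : E → A
  lab_src : ∀ e, S.src (lab e) = esrc e
  lab_tgt : ∀ e, S.tgt (lab e) = etgt e
  K : Set (List E)
  K_path : ∀ l ∈ K, l ≠ [] ∧ IsPathChain esrc etgt l
  K_onto : ∀ a : A, ∃ l ∈ K, evalPath? S lab l = some a

variable {O A E : Type} {S : PreSgpd O A}

/-- The relation `K_=` = {(u,v) ∈ K × K : u ρ = v ρ}. -/
def relEq (C : ChoiceOfReps S E) : Set (List E × List E) :=
  { p | p.1 ∈ C.K ∧ p.2 ∈ C.K ∧ evalPath? S C.lab p.1 = evalPath? S C.lab p.2 }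

/-- The relation `K_a` for an edge `a` of `X`. -/
def relEdge (C : ChoiceOfReps S E) (a : E) : Set (List E × List E) :=
  { p | p.1 ∈ C.K ∧ p.2 ∈ C.K ∧ pathTgt? C.etgt p.1 = some (C.esrc a) ∧
        evalPath? S C.lab (p.1 ++ [a]) = evalPath? S C.lab p.2 }

/-- The relation `K_a` for a vertex `a` of `X` (regarded as the empty path at `a`). -/
def relVertex (C : ChoiceOfReps S E) (v : O) : Set (List E × List E) :=
  { p | p.1 ∈ C.K ∧ p.2 ∈ C.K ∧ pathTgt? C.etgt p.1 = some v ∧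
        evalPath? S C.lab p.1 = evalPath? S C.lab p.2 }

/-- An automatic structure: a finitely generated choice of representatives with
`K` regular such that `K_a` is synchronously regular for every edge and vertex. -/
def IsAutomaticStructure (C : ChoiceOfReps S E) : Prop :=
  Finite E ∧ IsRegularSet C.K ∧
    (∀ a : E, SyncRegular C.etgt (relEdge C a)) ∧
    (∀ v : O, SyncRegular C.etgt (relVertex C v))

/-- The set of non-empty prefixes of words in `K`. -/
def prefs {E : Type} (K : Set (List E)) : Set (List E) :=
  { p | p ≠ [] ∧ ∃ l ∈ K, p <+: l }

/-- The relation `K'_=` = {(u,v) ∈ K × Pref(K) : u ρ = v ρ}. -/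
def relPrefEq (C : ChoiceOfReps S E) : Set (List E × List E) :=
  { p | p.1 ∈ C.K ∧ p.2 ∈ prefs C.K ∧ evalPath? S C.lab p.1 = evalPath? S C.lab p.2 }

/-- A prefix-automatic structure. -/
def IsPrefixAutomaticStructure (C : ChoiceOfReps S E) : Prop :=
  IsAutomaticStructure C ∧ SyncRegular C.etgt (relPrefEq C)

/-- A cross-section: `ρ` restricted to `K` is injective. -/
def IsCrossSection (C : ChoiceOfReps S E) : Prop :=
  ∀ u ∈ C.K, ∀ v ∈ C.K, evalPath? S C.lab u = evalPath? S C.lab v → u = v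

/-- `K` is closed under taking non-empty prefixes. -/
def IsPrefixClosed (C : ChoiceOfReps S E) : Prop :=
  ∀ l ∈ C.K, ∀ p : List E, p ≠ [] → p <+: l → p ∈ C.K

/-- A semigroupoid (or semigroup, in the one-object case) is automatic if it
admits an automatic structure. -/
def IsAutomatic (S : PreSgpd O A) : Prop :=
  ∃ (E : Type) (C : ChoiceOfReps S E), IsAutomaticStructure C

/-- Prefix-automaticity. -/
def IsPrefixAutomatic (S : PreSgpd O A) : Prop :=
  ∃ (E : Type) (C : ChoiceOfReps S E), IsPrefixAutomaticStructure C

/-- Finite generation: every arrow is a (composable) product of arrows from some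
fixed finite set. -/
def IsFG (S : PreSgpd O A) : Prop :=
  ∃ T : Set A, T.Finite ∧ ∀ a : A, ∃ l : List A, l ≠ [] ∧ (∀ x ∈ l, x ∈ T) ∧
    IsPathChain S.src S.tgt l ∧ evalPath? S id l = some a

/-- An arrow is an identity if it acts as an identity on all composable products. -/
def IsIdentity (S : PreSgpd O A) (e : A) : Prop :=
  (∀ x, S.tgt e = S.src x → S.mul e x = x) ∧ (∀ y, S.tgt y = S.src e → S.mul y e = y)

/-- A small category is a semigroupoid with an identity arrow at every object. -/
def IsSmallCategory (S : PreSgpd O A) : Prop :=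
  ∀ v : O, ∃ e : A, S.src e = v ∧ S.tgt e = v ∧ IsIdentity S e

/-- No object is isolated. -/
def IsolationFree (S : PreSgpd O A) : Prop :=
  ∀ v : O, ∃ a : A, S.src a = v ∨ S.tgt a = v

namespace Rees

variable {O A I Λ : Type}

/-- A triple `(i, x, λ)` is valid if `i F = x α` and `x ω = λ G`. -/
def Valid (S : Sgpd O A) (F : I → O) (G : Λ → O) (t : I × A × Λ) : Prop :=
  F t.1 = S.src t.2.1 ∧ S.tgt t.2.1 = G t.2.2

/-- The set of valid Rees triples. -/
def Triples (S : Sgpd O A) (F : I → O) (G : Λ → O) : Type :=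
  { t : I × A × Λ // Valid S F G t }

theorem prod_valid (S : Sgpd O A) {F : I → O} {G : Λ → O}
    {i : I} {x : A} {lam : Λ} {j : I} {y : A} {mu : Λ} {p : A}
    (hx : Valid S F G (i, x, lam)) (hy : Valid S F G (j, y, mu))
    (hps : S.src p = G lam) (hpt : S.tgt p = F j) :
    Valid S F G (i, S.mul (S.mul x p) y, mu) := by
  obtain ⟨hx1, hx2⟩ := hx
  obtain ⟨hy1, hy2⟩ := hy
  have h1 : S.tgt x = S.src p := by rw [hps]; exact hx2
  have h2 : S.tgt p = S.src y := by rw [hpt]; exact hy1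
  have h3 : S.tgt (S.mul x p) = S.src y := by rw [S.tgt_mul x p h1]; exact h2
  constructor
  · show F i = S.src (S.mul (S.mul x p) y)
    rw [S.src_mul _ y h3, S.src_mul x p h1]; exact hx1
  · show S.tgt (S.mul (S.mul x p) y) = G mu
    rw [S.tgt_mul _ y h3]; exact hy2

/-- Data for a Rees matrix construction with zero over a semigroupoid `S`:
indexing functions `F`, `G` surjective onto the sets of sources and of targets
respectively, and a sandwich matrix `P` with entries in `S^1 ∪ {0}`
(`none` representing `0`) compatible with `F` and `G`. -/
structure Data0 (S : Sgpd O A) (I Λ : Type) where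
  F : I → O
  G : Λ → O
  P : Λ → I → Option A
  F_into : ∀ i, ∃ a : A, S.src a = F i
  F_onto : ∀ a : A, ∃ i, F i = S.src a
  G_into : ∀ lam, ∃ a : A, S.tgt a = G lam
  G_onto : ∀ a : A, ∃ lam, G lam = S.tgt a
  P_src : ∀ lam i p, P lam i = some p → S.src p = G lam
  P_tgt : ∀ lam i p, P lam i = some p → S.tgt p = F i

/-- Underlying set of the Rees matrix semigroup with zero (`none` is the zero). -/
def Carrier0 (S : Sgpd O A) (R : Data0 S I Λ) : Type :=
  Option (Triples S R.F R.G)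

/-- Multiplication of the Rees matrix semigroup with zero. -/
def mul0 (S : Sgpd O A) (R : Data0 S I Λ) :
    Carrier0 S R → Carrier0 S R → Carrier0 S R
  | some ⟨(i, x, lam), hx⟩, some ⟨(j, y, mu), hy⟩ =>
    match hp : R.P lam j with
    | some p => some ⟨(i, S.mul (S.mul x p) y, mu),
        prod_valid S hx hy (R.P_src lam j p hp) (R.P_tgt lam j p hp)⟩
    | none => none
  | none, _ => none
  | _, none => none

/-- The Rees matrix semigroup with zero `M^0(S; F(I), G(Λ); P)`, as a
one-object semigroupoid (i.e. a semigroup). -/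
def pre0 (S : Sgpd O A) (R : Data0 S I Λ) : PreSgpd Unit (Carrier0 S R) where
  src _ := ()
  tgt _ := ()
  mul := mul0 S R

/-- Data for a Rees matrix construction without zero (no zero entries in `P`). -/
structure Data (S : Sgpd O A) (I Λ : Type) where
  F : I → O
  G : Λ → O
  P : Λ → I → A
  F_into : ∀ i, ∃ a : A, S.src a = F i
  F_onto : ∀ a : A, ∃ i, F i = S.src a
  G_into : ∀ lam, ∃ a : A, S.tgt a = G lam
  G_onto : ∀ a : A, ∃ lam, G lam = S.tgt a
  P_src : ∀ lam i, S.src (P lam i) = G lam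
  P_tgt : ∀ lam i, S.tgt (P lam i) = F i

/-- Underlying set of the Rees matrix semigroup without zero. -/
def Carrier (S : Sgpd O A) (R : Data S I Λ) : Type :=
  Triples S R.F R.G

/-- Multiplication of the Rees matrix semigroup without zero. -/
def mul (S : Sgpd O A) (R : Data S I Λ) :
    Carrier S R → Carrier S R → Carrier S R
  | ⟨(i, x, lam), hx⟩, ⟨(j, y, mu), hy⟩ =>
    ⟨(i, S.mul (S.mul x (R.P lam j)) y, mu),
      prod_valid S hx hy (R.P_src lam j) (R.P_tgt lam j)⟩

/-- The Rees matrix semigroup without zero `M(S; F(I), G(Λ); P)`, as a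
one-object semigroupoid (i.e. a semigroup). -/
def pre (S : Sgpd O A) (R : Data S I Λ) : PreSgpd Unit (Carrier S R) where
  src _ := ()
  tgt _ := ()
  mul := mul S R

/-- The set `S P' S` of arrows of the form `s p t` with `p` a non-zero entry of `P`. -/
def SPS0 (S : Sgpd O A) (R : Data0 S I Λ) : Set A :=
  { a | ∃ s p t lam i, R.P lam i = some p ∧ S.tgt s = S.src p ∧ S.tgt p = S.src t ∧
        a = S.mul (S.mul s p) t }

/-- The set `S P S` for a matrix without zero entries. -/
def SPS (S : Sgpd O A) (R : Data S I Λ) : Set A :=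
  { a | ∃ s t lam i, S.tgt s = S.src (R.P lam i) ∧ S.tgt (R.P lam i) = S.src t ∧
        a = S.mul (S.mul s (R.P lam i)) t }

/-- The set of targets of arrows of `S` (the codomain of `G`). -/
def tgtSet (S : Sgpd O A) : Set O := { v | ∃ a : A, S.tgt a = v }

/-- `T` is strongly right-ideal-generated by a row cross-section of `P`. -/
def StronglyRIG0 (S : Sgpd O A) (R : Data0 S I Λ) (T : Set A) : Prop :=
  ∃ Λ' : Set Λ, Set.BijOn R.G Λ' (tgtSet S) ∧
    ∀ t ∈ T, ∃ lam ∈ Λ', ∃ i p s, R.P lam i = some p ∧ S.tgt p = S.src s ∧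
      t = S.mul p s

/-- `T` is weakly right-ideal-generated by a row cross-section of `P`. -/
def WeaklyRIG0 (S : Sgpd O A) (R : Data0 S I Λ) (T : Set A) : Prop :=
  ∃ Λ' : Set Λ, Set.BijOn R.G Λ' (tgtSet S) ∧
    ∀ t ∈ T, ∃ lam ∈ Λ', ∃ i p, R.P lam i = some p ∧
      (t = p ∨ ∃ s, S.tgt p = S.src s ∧ t = S.mul p s)

/-- Weak right-ideal generation, for a matrix without zero entries. -/
def WeaklyRIG (S : Sgpd O A) (R : Data S I Λ) (T : Set A) : Prop :=
  ∃ Λ' : Set Λ, Set.BijOn R.G Λ' (tgtSet S) ∧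
    ∀ t ∈ T, ∃ lam ∈ Λ', ∃ i,
      (t = R.P lam i ∨ ∃ s, S.tgt (R.P lam i) = S.src s ∧ t = S.mul (R.P lam i) s)

end Rees


/-! ## Residual calculus for synchronously regular relations -/

section Residuals

theorem finite_range_of_factor {α β γ : Type*} {f : α → β} {g : α → γ}
    (hg : (Set.range g).Finite) (h : ∀ a a', g a = g a' → f a = f a') :
    (Set.range f).Finite := by
  classical
  rcases isEmpty_or_nonempty α with h0 | ⟨⟨a0⟩⟩
  · rw [Set.range_eq_empty f]; exact Set.finite_empty
  · refine (hg.image (Function.extend g f (fun _ => f a0))).subset ?_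
    rintro _ ⟨a, rfl⟩
    refine ⟨g a, ⟨a, rfl⟩, ?_⟩
    have : Function.FactorsThrough f g := fun a a' haa => h a a' haa
    exact this.extend_apply _ _

theorem finite_range_prod {α β γ : Type*} {f : α → β} {g : α → γ}
    (hf : (Set.range f).Finite) (hg : (Set.range g).Finite) :
    (Set.range fun a => (f a, g a)).Finite := by
  refine (hf.prod hg).subset ?_
  rintro _ ⟨a, rfl⟩
  exact ⟨⟨a, rfl⟩, ⟨a, rfl⟩⟩

theorem finite_range_comp {α β γ : Type*} {f : β → γ} (g : α → β)
    (hf : (Set.range f).Finite) : (Set.range fun a => f (g a)).Finite := by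
  refine hf.subset ?_
  rintro _ ⟨a, rfl⟩
  exact ⟨g a, rfl⟩

/-- Compatibility of a continuation with a pair of prefixes. -/
def Compat {α β : Type} (p q : List α × List β) : Prop :=
  (p.1.length < p.2.length → q.1 = []) ∧ (p.2.length < p.1.length → q.2 = [])

/-- Residual of a relation by a pair of prefixes. -/
def res {α β : Type} (R : Set (List α × List β)) (p : List α × List β) :
    Set (List α × List β) :=
  { q | (p.1 ++ q.1, p.2 ++ q.2) ∈ R ∧ Compat p q }

/-- Finitely many residuals. -/
def FinRes {α β : Type} (R : Set (List α × List β)) : Prop := (Set.range (res R)).Finite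

/-- Left quotient of a set of words. -/
def lq {α : Type} (L : Set (List α)) (a : List α) : Set (List α) := { z | a ++ z ∈ L }

theorem regular_iff_lq {α : Type} (L : Set (List α)) :
    IsRegularSet L ↔ (Set.range (lq L)).Finite :=
  ⟨fun h => Language.IsRegular.finite_range_leftQuotient h,
   fun h => Language.IsRegular.of_finite_range_leftQuotient h⟩

theorem finRes_of_factor {α β : Type} {γ : Type*} {R : Set (List α × List β)}
    {g : List α × List β → γ} (hg : (Set.range g).Finite)
    (h : ∀ p p', g p = g p' → ∀ q, q ∈ res R p → q ∈ res R p') : FinRes R :=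
  finite_range_of_factor hg fun p p' hpp =>
    Set.Subset.antisymm (h p p' hpp) (h p' p hpp.symm)

theorem finRes_inter {α β : Type} {R R' : Set (List α × List β)}
    (h : FinRes R) (h' : FinRes R') : FinRes (R ∩ R') := by
  refine finRes_of_factor (finite_range_prod h h') ?_
  intro p p' hpp q hq
  simp only [Prod.mk.injEq] at hpp
  have h1 : q ∈ res R p := ⟨hq.1.1, hq.2⟩
  have h2 : q ∈ res R' p := ⟨hq.1.2, hq.2⟩
  rw [hpp.1] at h1
  rw [hpp.2] at h2
  exact ⟨⟨h1.1, h2.1⟩, h1.2⟩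

theorem finRes_iUnion {α β ι : Type} [Finite ι] {R : ι → Set (List α × List β)}
    (h : ∀ i, FinRes (R i)) : FinRes (⋃ i, R i) := by
  have hfin : (Set.range fun p => fun i => res (R i) p).Finite := by
    refine (Set.Finite.pi' (fun i => h i)).subset ?_
    rintro _ ⟨p, rfl⟩ i
    exact ⟨p, rfl⟩
  refine finRes_of_factor hfin ?_
  intro p p' hpp q hq
  obtain ⟨i, hi⟩ := Set.mem_iUnion.1 hq.1
  have h1 : q ∈ res (R i) p := ⟨hi, hq.2⟩
  have := congrFun hpp i
  rw [this] at h1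
  exact ⟨Set.mem_iUnion.2 ⟨i, h1.1⟩, h1.2⟩

theorem finite_range_prop {α : Type*} (f : α → Prop) : (Set.range f).Finite := Set.toFinite _

theorem finRes_comp {α β γ : Type} {R : Set (List α × List β)} {R' : Set (List β × List γ)}
    (h : FinRes R) (h' : FinRes R') :
    FinRes { p : List α × List γ | ∃ b, (p.1, b) ∈ R ∧ (b, p.2) ∈ R' } := by
  have hfin : (Set.range fun p : List α × List γ =>
      { t | ∃ b, t = (res R (p.1, b), res R' (b, p.2)) }).Finite := by
    refine ((h.prod h').finite_subsets).subset ?_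
    rintro _ ⟨p, rfl⟩ _ ⟨b, rfl⟩
    exact ⟨⟨_, rfl⟩, ⟨_, rfl⟩⟩
  refine finRes_of_factor (finite_range_prod hfin (finite_range_prod
    (finite_range_prop fun p : List α × List γ => p.1.length < p.2.length)
    (finite_range_prop fun p : List α × List γ => p.2.length < p.1.length))) ?_
  rintro ⟨a, c⟩ ⟨a', c'⟩ hpp ⟨x, z⟩ ⟨⟨b, hb1, hb2⟩, hc⟩
  simp only [Prod.mk.injEq] at hpp
  obtain ⟨e1, e2, e3⟩ := hpp
  set n := max a.length c.length with hn
  have hbs : b = b.take n ++ b.drop n := (List.take_append_drop n b).symm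
  have hdrop : (b.take n).length < n → b.drop n = [] := by
    intro hlt
    rw [List.length_take] at hlt
    exact List.drop_eq_nil_of_le (by omega)
  have hle : (b.take n).length ≤ n := by rw [List.length_take]; omega
  simp only [Compat] at hc
  have m1 : (x, b.drop n) ∈ res R (a, b.take n) := by
    refine ⟨by simpa using hb1, ?_, ?_⟩
    · intro hl
      simp only at hl
      exact hc.1 (by omega)
    · intro hl
      simp only at hl
      exact hdrop (by omega)
  have m2 : (b.drop n, z) ∈ res R' (b.take n, c) := by
    refine ⟨by simpa using hb2, ?_, ?_⟩
    · intro hl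
      simp only at hl
      exact hdrop (by omega)
    · intro hl
      simp only at hl
      exact hc.2 (by omega)
  have hmem : (res R (a, b.take n), res R' (b.take n, c)) ∈
      { t | ∃ b, t = (res R (a, b), res R' (b, c)) } := ⟨_, rfl⟩
  rw [e1] at hmem
  obtain ⟨b', hb'⟩ := hmem
  simp only [Prod.mk.injEq] at hb'
  rw [hb'.1] at m1
  rw [hb'.2] at m2
  refine ⟨⟨b' ++ b.drop n, m1.1, m2.1⟩, ?_, ?_⟩
  · intro hl
    exact hc.1 (by rw [e2]; exact hl)
  · intro hl
    exact hc.2 (by rw [e3]; exact hl)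

/-- Residuals without the compatibility constraint, for prefixes of nearby lengths. -/
theorem finite_near {α β : Type} [Finite α] [Finite β] {R : Set (List α × List β)}
    (h : FinRes R) (D : ℕ) :
    (Set.range fun p : List α × List β =>
      { q : List α × List β | p.1.length ≤ p.2.length + D ∧ p.2.length ≤ p.1.length + D ∧
        (p.1 ++ q.1, p.2 ++ q.2) ∈ R }).Finite := by
  have hf := (((h.prod ((List.finite_length_le α D).prod (List.finite_length_le β D))).image
    (fun t : Set (List α × List β) × (List α × List β) =>
      { q : List α × List β | (t.2.1 ++ q.1, t.2.2 ++ q.2) ∈ t.1 })).insert ∅)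
  refine hf.subset ?_
  rintro _ ⟨⟨a, b⟩, rfl⟩
  by_cases hd : a.length ≤ b.length + D ∧ b.length ≤ a.length + D
  · right
    set n := min a.length b.length with hn
    refine ⟨(res R (a.take n, b.take n), (a.drop n, b.drop n)), ⟨⟨_, rfl⟩, ?_, ?_⟩, ?_⟩
    · simp only [Set.mem_ofPred_eq, List.length_drop]; omega
    · simp only [Set.mem_ofPred_eq, List.length_drop]; omega
    · ext ⟨c, d⟩
      have hl : (a.take n).length = (b.take n).length := by
        simp only [List.length_take]; omega
      simp only [res, Compat, Set.mem_ofPred_eq, hd.1, hd.2, true_and]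
      simp only [← List.append_assoc, List.take_append_drop]
      simp [hl]
  · left
    ext q
    simp only [Set.mem_ofPred_eq, Set.mem_empty_iff_false, iff_false]
    intro hq
    exact hd ⟨hq.1, hq.2.1⟩

end Residuals

/-! ## Synchronous regularity in terms of residuals -/

section Sync

/-- Convolution with prescribed padding symbols. -/
def dl {V E : Type} (p q : E ⊕ Option V) (a b : List E) :
    List ((E ⊕ Option V) × (E ⊕ Option V)) :=
  (a.map Sum.inl).zip (b.map Sum.inl) ++
    (if a.length ≤ b.length
      then (b.drop a.length).map (fun e => (p, Sum.inl e))
      else (a.drop b.length).map (fun e => (Sum.inl e, q)))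

theorem deltaPair_eq_dl {V E : Type} (etgt : E → V) (a b : List E) :
    deltaPair etgt a b = dl (padSym etgt a) (padSym etgt b) a b := rfl

theorem dl_nil_left {V E : Type} (p q : E ⊕ Option V) (d : List E) :
    dl p q [] d = d.map (fun e => (p, Sum.inl e)) := by simp [dl]

theorem dl_nil_right {V E : Type} (p q : E ⊕ Option V) (c : List E) :
    dl p q c [] = c.map (fun e => (Sum.inl e, q)) := by
  cases c <;> simp [dl]

theorem dl_cons {V E : Type} (p q : E ⊕ Option V) (x y : E) (a b : List E) :
    dl p q (x :: a) (y :: b) = (Sum.inl x, Sum.inl y) :: dl p q a b := by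
  simp [dl]

theorem dl_append {V E : Type} (p q : E ⊕ Option V) (a b c d : List E)
    (h : Compat (a, b) (c, d)) :
    dl p q (a ++ c) (b ++ d) = dl p q a b ++ dl p q c d := by
  induction a generalizing b with
  | nil =>
    cases b with
    | nil => simp [dl_nil_left]
    | cons y b =>
      have hc : c = [] := h.1 (by simp)
      subst hc
      simp [dl_nil_left]
  | cons x a ih =>
    cases b with
    | nil =>
      have hc : d = [] := h.2 (by simp)
      subst hc
      simp [dl_nil_right]
    | cons y b =>
      simp only [List.cons_append, dl_cons]
      rw [ih b]
      simpa [Compat] using h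

theorem dl_congr {V E : Type} {p q p' q' : E ⊕ Option V} (a b : List E)
    (hp : a.length < b.length → p = p') (hq : b.length < a.length → q = q') :
    dl p q a b = dl p' q' a b := by
  unfold dl
  congr 1
  rcases lt_trichotomy a.length b.length with h | h | h
  · rw [hp h]; simp [h.le]
  · simp [h]
  · rw [hq h]; simp [h.not_ge]

theorem dl_fst {V E : Type} (p q : Option V) (a b : List E) :
    (dl (Sum.inr p) (Sum.inr q) a b).filterMap (fun t => t.1.getLeft?) = a := by
  induction a generalizing b with
  | nil => simp [dl_nil_left, List.filterMap_map, Function.comp_def]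
  | cons x a ih =>
    cases b with
    | nil => simp [dl_nil_right, List.filterMap_map, Function.comp_def]
    | cons y b => simp [dl_cons, ih]

theorem dl_snd {V E : Type} (p q : Option V) (a b : List E) :
    (dl (Sum.inr p) (Sum.inr q) a b).filterMap (fun t => t.2.getLeft?) = b := by
  induction a generalizing b with
  | nil => simp [dl_nil_left, List.filterMap_map, Function.comp_def]
  | cons x a ih =>
    cases b with
    | nil => simp [dl_nil_right, List.filterMap_map, Function.comp_def]
    | cons y b => simp [dl_cons, ih]

theorem deltaPair_inj {V E : Type} {etgt : E → V} {a b a' b' : List E}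
    (h : deltaPair etgt a b = deltaPair etgt a' b') : a = a' ∧ b = b' := by
  rw [deltaPair_eq_dl, deltaPair_eq_dl] at h
  constructor
  · have := congrArg (List.filterMap (fun t => t.1.getLeft?)) h
    simpa only [padSym, dl_fst] using this
  · have := congrArg (List.filterMap (fun t => t.2.getLeft?)) h
    simpa only [padSym, dl_snd] using this

theorem length_dl {V E : Type} (p q : E ⊕ Option V) (a b : List E) :
    (dl p q a b).length = max a.length b.length := by
  unfold dl
  split_ifs with h <;> simp <;> omega

open Classical in
/-- The part of the convolution contributed by a continuation. -/
noncomputable def tl {V E : Type} (etgt : E → V) (p q : E ⊕ Option V) (c d : List E) :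
    List ((E ⊕ Option V) × (E ⊕ Option V)) :=
  dl (if c = [] then p else padSym etgt c) (if d = [] then q else padSym etgt d) c d

open Classical in
theorem padSym_append {V E : Type} (etgt : E → V) (a c : List E) :
    padSym etgt (a ++ c) = if c = [] then padSym etgt a else padSym etgt c := by
  split_ifs with h
  · simp [h]
  · unfold padSym
    rw [List.getLast?_append_of_ne_nil _ h]

theorem deltaPair_append {V E : Type} (etgt : E → V) (a b c d : List E)
    (h : Compat (a, b) (c, d)) :
    deltaPair etgt (a ++ c) (b ++ d) =
      deltaPair etgt a b ++ tl etgt (padSym etgt a) (padSym etgt b) c d := by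
  rw [deltaPair_eq_dl, dl_append _ _ _ _ _ _ h, deltaPair_eq_dl, tl, ← padSym_append,
    ← padSym_append]
  congr 1
  apply dl_congr
  · intro hl
    have : c = [] := h.1 hl
    simp [this]
  · intro hl
    have : d = [] := h.2 hl
    simp [this]

theorem deltaPair_split {V E : Type} {etgt : E → V} {a' b' : List E}
    {w z : List ((E ⊕ Option V) × (E ⊕ Option V))}
    (h : w ++ z = deltaPair etgt a' b') :
    ∃ a b c d, a' = a ++ c ∧ b' = b ++ d ∧ Compat (a, b) (c, d) ∧
      w = deltaPair etgt a b ∧ z = tl etgt (padSym etgt a) (padSym etgt b) c d := by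
  have hlen := congrArg List.length h
  rw [deltaPair_eq_dl, length_dl, List.length_append] at hlen
  set n := w.length with hn
  have hc : Compat (a'.take n, b'.take n) (a'.drop n, b'.drop n) := by
    constructor
    · intro hl
      simp only [List.length_take] at hl
      exact List.drop_eq_nil_of_le (by omega)
    · intro hl
      simp only [List.length_take] at hl
      exact List.drop_eq_nil_of_le (by omega)
  have h2 := deltaPair_append etgt _ _ _ _ hc
  rw [List.take_append_drop, List.take_append_drop, ← h] at h2
  have h3 := List.append_inj h2 (by
    rw [deltaPair_eq_dl, length_dl]; simp only [List.length_take]; omega)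
  exact ⟨_, _, _, _, (List.take_append_drop n a').symm, (List.take_append_drop n b').symm, hc,
    h3.1, h3.2⟩

theorem finite_range_padSym {V E : Type} [Finite E] (etgt : E → V) :
    (Set.range (padSym etgt)).Finite := by
  refine finite_range_of_factor (g := fun l : List E => l.getLast?) (Set.toFinite _) ?_
  intro a a' h
  simp [padSym, h]

theorem SyncRegular.finRes {V E : Type} [Finite E] {etgt : E → V}
    {R : Set (List E × List E)} (h : SyncRegular etgt R) : FinRes R := by
  unfold SyncRegular at h
  rw [regular_iff_lq] at h
  set Ld := { w | ∃ p ∈ R, w = deltaPair etgt p.1 p.2 } with hLd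
  have hmem : ∀ a b, deltaPair etgt a b ∈ Ld ↔ (a, b) ∈ R := by
    intro a b
    constructor
    · rintro ⟨⟨a', b'⟩, hp, he⟩
      obtain ⟨rfl, rfl⟩ := deltaPair_inj he
      exact hp
    · intro hp
      exact ⟨_, hp, rfl⟩
  have hP := finite_range_padSym etgt
  refine finRes_of_factor (finite_range_prod
    (finite_range_comp (fun p : List E × List E => deltaPair etgt p.1 p.2) h)
    (finite_range_prod (finite_range_comp (fun p : List E × List E => p.1) hP)
    (finite_range_prod (finite_range_comp (fun p : List E × List E => p.2) hP)
    (finite_range_prod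
    (finite_range_prop fun p : List E × List E => p.1.length < p.2.length)
    (finite_range_prop fun p : List E × List E => p.2.length < p.1.length))))) ?_
  rintro ⟨a, b⟩ ⟨a', b'⟩ hpp ⟨c, d⟩ ⟨h1, h2⟩
  simp only [Prod.mk.injEq] at hpp
  obtain ⟨e1, e2, e3, e4, e5⟩ := hpp
  have hc' : Compat (a', b') (c, d) := by
    refine ⟨fun hl => h2.1 ?_, fun hl => h2.2 ?_⟩
    · simp only at hl ⊢; rw [e4]; exact hl
    · simp only at hl ⊢; rw [e5]; exact hl
  refine ⟨?_, hc'⟩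
  simp only at h1 ⊢
  rw [← hmem, deltaPair_append _ _ _ _ _ h2] at h1
  have h3 : tl etgt (padSym etgt a) (padSym etgt b) c d ∈ lq Ld (deltaPair etgt a b) := h1
  rw [e1, e2, e3] at h3
  rw [← hmem, deltaPair_append _ _ _ _ _ hc']
  exact h3

theorem FinRes.syncRegular {V E : Type} [Finite E] (etgt : E → V)
    {R : Set (List E × List E)} (h : FinRes R) : SyncRegular etgt R := by
  unfold SyncRegular
  rw [regular_iff_lq]
  have hP := finite_range_padSym etgt
  refine (((h.prod (hP.prod hP)).image (fun t =>
    { z | ∃ q ∈ t.1, z = tl etgt t.2.1 t.2.2 q.1 q.2 })).insert ∅).subset ?_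
  rintro _ ⟨w, rfl⟩
  rcases Set.eq_empty_or_nonempty (lq { w | ∃ p ∈ R, w = deltaPair etgt p.1 p.2 } w) with he | hn
  · left; exact he
  · right
    obtain ⟨z, ⟨a', b'⟩, hp, hz⟩ := hn
    obtain ⟨a, b, c, d, -, -, -, hw, -⟩ := deltaPair_split hz
    refine ⟨(res R (a, b), padSym etgt a, padSym etgt b), ⟨⟨_, rfl⟩, ⟨_, rfl⟩, ⟨_, rfl⟩⟩, ?_⟩
    ext z
    constructor
    · rintro ⟨⟨c, d⟩, hq, rfl⟩
      refine ⟨(a ++ c, b ++ d), hq.1, ?_⟩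
      rw [hw]
      exact (deltaPair_append _ _ _ _ _ hq.2).symm
    · rintro ⟨⟨a1, b1⟩, hp1, hz1⟩
      obtain ⟨a2, b2, c, d, h1, h2, h3, h4, h5⟩ := deltaPair_split hz1
      obtain ⟨rfl, rfl⟩ := deltaPair_inj (hw.symm.trans h4)
      simp only at h1 h2
      subst h1 h2
      exact ⟨(c, d), ⟨hp1, h3⟩, h5⟩

end Sync

/-! ## Evaluation of paths in a semigroupoid -/

section Paths

/-- Total version of path evaluation (with a junk value on the empty path). -/
noncomputable def ev {O A X : Type} [Nonempty A] (S : PreSgpd O A) (lab : X → A) : List X → A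
  | [] => Classical.arbitrary A
  | e :: l => (l.map lab).foldl S.mul (lab e)

theorem evalPath?_eq {O A X : Type} [Nonempty A] (S : PreSgpd O A) (lab : X → A) {l : List X}
    (h : l ≠ []) : evalPath? S lab l = some (ev S lab l) := by
  cases l with
  | nil => exact absurd rfl h
  | cons e l => rfl

theorem ev_append {O A X : Type} [Nonempty A] (S : PreSgpd O A) (lab : X → A) {u : List X}
    (h : u ≠ []) (v : List X) :
    ev S lab (u ++ v) = (v.map lab).foldl S.mul (ev S lab u) := by
  cases u with
  | nil => exact absurd rfl h
  | cons e l => simp [ev]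

theorem fold_facts {O A X : Type} (S : Sgpd O A) (C : ChoiceOfReps S.toPreSgpd X)
    (t : List X) : ∀ (e : X) (x : A), IsPathChain C.esrc C.etgt (e :: t) → S.tgt x = C.etgt e →
    S.src ((t.map C.lab).foldl S.mul x) = S.src x ∧
    (∀ f ∈ (e :: t).getLast?, S.tgt ((t.map C.lab).foldl S.mul x) = C.etgt f) ∧
    ∀ z, S.tgt z = S.src x →
      (t.map C.lab).foldl S.mul (S.mul z x) = S.mul z ((t.map C.lab).foldl S.mul x) := by
  induction t with
  | nil => intro e x _ h; simp [h]
  | cons f t ih =>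
    intro e x hch hx
    have hch' : C.etgt e = C.esrc f ∧ IsPathChain C.esrc C.etgt (f :: t) := by
      unfold IsPathChain List.Chain' at hch
      exact List.isChain_cons_cons.1 hch
    have hxf : S.tgt x = S.src (C.lab f) := by rw [hx, hch'.1, C.lab_src]
    have ht : S.tgt (S.mul x (C.lab f)) = C.etgt f := by rw [S.tgt_mul _ _ hxf, C.lab_tgt]
    obtain ⟨h1, h2, h3⟩ := ih f (S.mul x (C.lab f)) hch'.2 ht
    refine ⟨?_, ?_, ?_⟩
    · simp only [List.map_cons, List.foldl_cons]
      rw [h1, S.src_mul _ _ hxf]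
    · intro g hg
      simp only [List.map_cons, List.foldl_cons]
      apply h2
      simpa [List.getLast?_cons_cons] using hg
    · intro z hz
      simp only [List.map_cons, List.foldl_cons]
      rw [S.mul_assoc' _ _ _ hz hxf]
      apply h3
      rw [S.src_mul _ _ hxf, hz]

theorem ev_src {O A X : Type} [Nonempty A] (S : Sgpd O A) (C : ChoiceOfReps S.toPreSgpd X)
    {e : X} {t : List X} (h : IsPathChain C.esrc C.etgt (e :: t)) :
    S.src (ev S.toPreSgpd C.lab (e :: t)) = C.esrc e := by
  have := (fold_facts S C t e (C.lab e) h (C.lab_tgt e)).1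
  rw [C.lab_src] at this
  exact this

theorem ev_tgt {O A X : Type} [Nonempty A] (S : Sgpd O A) (C : ChoiceOfReps S.toPreSgpd X)
    {u : List X} (h : IsPathChain C.esrc C.etgt u) :
    ∀ f ∈ u.getLast?, S.tgt (ev S.toPreSgpd C.lab u) = C.etgt f := by
  cases u with
  | nil => simp
  | cons e t => exact (fold_facts S C t e (C.lab e) h (C.lab_tgt e)).2.1

theorem fold_eq_mul {O A X : Type} [Nonempty A] (S : Sgpd O A) (C : ChoiceOfReps S.toPreSgpd X)
    {u : List X} (h : IsPathChain C.esrc C.etgt u) (hu : u ≠ []) {x : A}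
    (hx : S.tgt x = S.src (ev S.toPreSgpd C.lab u)) :
    (u.map C.lab).foldl S.mul x = S.mul x (ev S.toPreSgpd C.lab u) := by
  cases u with
  | nil => exact absurd rfl hu
  | cons e t =>
    rw [ev_src S C h] at hx
    exact (fold_facts S C t e (C.lab e) h (C.lab_tgt e)).2.2 x (by rw [hx, C.lab_src])

theorem chain_append {V X : Type} {esrc etgt : X → V} {u v : List X} :
    IsPathChain esrc etgt (u ++ v) ↔ IsPathChain esrc etgt u ∧ IsPathChain esrc etgt v ∧
      ∀ x ∈ u.getLast?, ∀ y ∈ v.head?, etgt x = esrc y := by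
  unfold IsPathChain List.Chain'
  exact List.isChain_append

theorem ev_mul {O A X : Type} [Nonempty A] (S : Sgpd O A) (C : ChoiceOfReps S.toPreSgpd X)
    {u v : List X} (h : IsPathChain C.esrc C.etgt (u ++ v)) (hu : u ≠ []) (hv : v ≠ []) :
    S.tgt (ev S.toPreSgpd C.lab u) = S.src (ev S.toPreSgpd C.lab v) ∧
    ev S.toPreSgpd C.lab (u ++ v) =
      S.mul (ev S.toPreSgpd C.lab u) (ev S.toPreSgpd C.lab v) := by
  obtain ⟨h1, h2, h3⟩ := chain_append.1 h
  have key : S.tgt (ev S.toPreSgpd C.lab u) = S.src (ev S.toPreSgpd C.lab v) := by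
    cases v with
    | nil => exact absurd rfl hv
    | cons e t =>
      rw [ev_src S C h2, ev_tgt S C h1 (u.getLast hu) (by simp [List.getLast?_eq_getLast_of_ne_nil hu])]
      exact h3 _ (by simp [List.getLast?_eq_getLast_of_ne_nil hu]) e (by simp)
  refine ⟨key, ?_⟩
  rw [ev_append _ _ hu, fold_eq_mul S C h2 hv key]

/-- Identity letters in front of a nonempty path can be dropped. -/
theorem ev_drop_left {O A X : Type} [Nonempty A] (S : Sgpd O A) (C : ChoiceOfReps S.toPreSgpd X)
    {g r : List X} (hg : ∀ e ∈ g, IsIdentity S.toPreSgpd (C.lab e)) (hr : r ≠ [])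
    (h : IsPathChain C.esrc C.etgt (g ++ r)) :
    ev S.toPreSgpd C.lab (g ++ r) = ev S.toPreSgpd C.lab r := by
  induction g with
  | nil => rfl
  | cons e g ih =>
    have h' : IsPathChain C.esrc C.etgt ([e] ++ (g ++ r)) := h
    have := ev_mul S C h' (by simp) (by simp [hr])
    have hid := (hg e (by simp)).1
    have he : ev S.toPreSgpd C.lab [e] = C.lab e := rfl
    rw [he] at this
    rw [show e :: g ++ r = [e] ++ (g ++ r) from rfl, this.2, hid _ this.1]
    exact ih (fun f hf => hg f (by simp [hf])) (chain_append.1 h').2.1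

/-- Identity letters after a nonempty path can be dropped. -/
theorem ev_drop_right {O A X : Type} [Nonempty A] (S : Sgpd O A) (C : ChoiceOfReps S.toPreSgpd X)
    {p g : List X} (hg : ∀ e ∈ g, IsIdentity S.toPreSgpd (C.lab e)) (hp : p ≠ [])
    (h : IsPathChain C.esrc C.etgt (p ++ g)) :
    ev S.toPreSgpd C.lab (p ++ g) = ev S.toPreSgpd C.lab p := by
  induction g generalizing p with
  | nil => simp
  | cons e g ih =>
    have h' : IsPathChain C.esrc C.etgt ((p ++ [e]) ++ g) := by simpa using h
    have h1 := ev_mul S C (chain_append.1 h').1 hp (by simp)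
    have hid := (hg e (by simp)).2
    have he : ev S.toPreSgpd C.lab [e] = C.lab e := rfl
    rw [he] at h1
    rw [show p ++ e :: g = (p ++ [e]) ++ g by simp,
      ih (fun f hf => hg f (by simp [hf])) (by simp) h', h1.2, hid _ h1.1]

theorem ev_drop {O A X : Type} [Nonempty A] (S : Sgpd O A) (C : ChoiceOfReps S.toPreSgpd X)
    {p g r : List X} (hg : ∀ e ∈ g, IsIdentity S.toPreSgpd (C.lab e)) (hpr : p ++ r ≠ [])
    (h : IsPathChain C.esrc C.etgt (p ++ g ++ r)) :
    ev S.toPreSgpd C.lab (p ++ g ++ r) = ev S.toPreSgpd C.lab (p ++ r) := by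
  by_cases hp : p = []
  · subst hp
    simp only [List.nil_append] at *
    exact ev_drop_left S C hg hpr h
  · rw [ev_append _ _ (by simp [hp]), ev_drop_right S C hg hp (chain_append.1 h).1,
      ← ev_append _ _ hp]

/-- The arrow `x` factors as a matrix entry times an arrow. -/
def GoodArrow {O A I Λ : Type} (S : Sgpd O A) (R : Rees.Data S I Λ) (x : A) : Prop :=
  ∃ lam i s, R.F i = S.src s ∧ x = S.mul (R.P lam i) s

/-- In a shortest representative, every long enough factor evaluates to a good arrow. -/
theorem exists_good {O A I Λ X : Type} [Nonempty A] (S : Sgpd O A) (R : Rees.Data S I Λ)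
    (hrig : Rees.WeaklyRIG S R { a : A | ¬ IsIdentity S.toPreSgpd a })
    (C : ChoiceOfReps S.toPreSgpd X) (hK : IsRegularSet C.K) :
    ∃ D : ℕ, 0 < D ∧ ∀ a : A, ∃ u ∈ C.K, ev S.toPreSgpd C.lab u = a ∧
      ∀ f, f <:+: u → D ≤ f.length → GoodArrow S R (ev S.toPreSgpd C.lab f) := by
  classical
  rw [regular_iff_lq] at hK
  set N := hK.toFinset.card with hN
  refine ⟨N + 1, by omega, ?_⟩
  intro a
  have hex : ∃ n, ∃ u ∈ C.K, ev S.toPreSgpd C.lab u = a ∧ u.length = n := by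
    obtain ⟨l, hl, he⟩ := C.K_onto a
    rw [evalPath?_eq _ _ (C.K_path l hl).1] at he
    exact ⟨_, l, hl, by simpa using he, rfl⟩
  obtain ⟨u, huK, hua, hun⟩ := Nat.find_spec hex
  have hmin : ∀ v ∈ C.K, ev S.toPreSgpd C.lab v = a → u.length ≤ v.length := by
    intro v hv hva
    rw [hun]
    exact Nat.find_min' hex ⟨v, hv, hva, rfl⟩
  refine ⟨u, huK, hua, ?_⟩
  rintro f ⟨p, r, hpfr⟩ hf
  have hpath := (C.K_path u huK).2
  have hfpath : IsPathChain C.esrc C.etgt f := by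
    rw [← hpfr] at hpath
    exact (chain_append.1 (chain_append.1 hpath).1).2.1
  -- some letter among the first `N` is not an identity
  have hnon : ∃ e ∈ f.take N, ¬ IsIdentity S.toPreSgpd (C.lab e) := by
    by_contra hcon
    push Not at hcon
    have hpig := Finset.exists_ne_map_eq_of_card_lt_of_maps_to
      (s := Finset.range (N + 1)) (t := hK.toFinset)
      (f := fun k => lq C.K (p ++ f.take k)) (by simp [hN])
      (by intro k _; simp)
    obtain ⟨k, hk, l, hl, hkl, heq⟩ := hpig
    have main : ∀ k l, k < l → l ≤ N → lq C.K (p ++ f.take k) = lq C.K (p ++ f.take l) →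
        False := by
      intro k l hkl hl heq
      have hsplit : f = f.take k ++ (f.take l).drop k ++ f.drop l := by
        have h1 : f.take k = (f.take l).take k := by
          rw [List.take_take]; congr 1; omega
        rw [h1, List.take_append_drop, List.take_append_drop]
      have hmem : f.drop l ++ r ∈ lq C.K (p ++ f.take l) := by
        show p ++ f.take l ++ (f.drop l ++ r) ∈ C.K
        have : p ++ f.take l ++ (f.drop l ++ r) = u := by
          rw [← hpfr]
          rw [List.append_assoc p, ← List.append_assoc (f.take l), List.take_append_drop,
            List.append_assoc]
        rw [this]; exact huK
      rw [← heq] at hmem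
      have hmem' : (p ++ f.take k) ++ (f.drop l ++ r) ∈ C.K := hmem
      have hu' : u = (p ++ f.take k) ++ (f.take l).drop k ++ (f.drop l ++ r) := by
        rw [← hpfr]
        conv_lhs => rw [hsplit]
        simp
      have hev := ev_drop S C (p := p ++ f.take k) (g := (f.take l).drop k) (r := f.drop l ++ r)
        (by
          intro e he
          apply hcon
          have h1 : e ∈ f.take l := List.mem_of_mem_drop he
          have h2 : f.take l = (f.take N).take l := by
            rw [List.take_take]; congr 1; omega
          rw [h2] at h1
          exact List.mem_of_mem_take h1)
        (C.K_path _ hmem').1 (by rw [← hu']; exact hpath)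
      rw [← hu', hua] at hev
      have hlen := hmin _ hmem' hev.symm
      rw [hu'] at hlen
      simp only [List.length_append, List.length_drop, List.length_take] at hlen
      omega
    have hk' : k ≤ N := by simpa [Nat.lt_succ_iff] using hk
    have hl' : l ≤ N := by simpa [Nat.lt_succ_iff] using hl
    rcases lt_or_gt_of_ne hkl with h | h
    · exact main k l h hl' heq
    · exact main l k h hk' heq.symm
  -- split at the first non-identity
  have hfirst : ∀ t : List X, (∃ e ∈ t, ¬ IsIdentity S.toPreSgpd (C.lab e)) →
      ∃ g e t', t = g ++ e :: t' ∧ (∀ x ∈ g, IsIdentity S.toPreSgpd (C.lab x)) ∧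
        ¬ IsIdentity S.toPreSgpd (C.lab e) := by
    intro t
    induction t with
    | nil => simp
    | cons x t ih =>
      intro hx
      by_cases hxi : IsIdentity S.toPreSgpd (C.lab x)
      · have : ∃ e ∈ t, ¬ IsIdentity S.toPreSgpd (C.lab e) := by
          obtain ⟨e, he, hne⟩ := hx
          rcases List.mem_cons.1 he with rfl | he
          · exact absurd hxi hne
          · exact ⟨e, he, hne⟩
        obtain ⟨g, e, t', rfl, hg, he⟩ := ih this
        refine ⟨x :: g, e, t', rfl, ?_, he⟩
        intro y hy
        rcases List.mem_cons.1 hy with rfl | hy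
        · exact hxi
        · exact hg y hy
      · exact ⟨[], x, t, rfl, by simp, hxi⟩
  obtain ⟨g, e, t', hsplit, hg, he⟩ := hfirst _ hnon
  set rest := t' ++ f.drop N with hrest
  have hrne : rest ≠ [] := by
    intro h0
    have := congrArg List.length h0
    simp only [hrest, List.length_append, List.length_drop, List.length_nil] at this
    omega
  have hfs : f = g ++ ([e] ++ rest) := by
    conv_lhs => rw [← List.take_append_drop N f, hsplit]
    simp [hrest]
  rw [hfs] at hfpath ⊢
  rw [ev_drop_left S C hg (by simp) hfpath]
  obtain ⟨hm1, hm2⟩ := ev_mul S C (chain_append.1 hfpath).2.1 (by simp) hrne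
  rw [hm2]
  have he1 : ev S.toPreSgpd C.lab [e] = C.lab e := rfl
  rw [he1] at hm1 ⊢
  obtain ⟨Λ', -, hΛ⟩ := hrig
  obtain ⟨lam, -, i, hP | ⟨s, hs1, hs2⟩⟩ := hΛ _ he
  · refine ⟨lam, i, ev S.toPreSgpd C.lab rest, ?_, ?_⟩
    · rw [← R.P_tgt lam i, ← hP, hm1]
    · rw [hP]
  · have h1 : S.tgt s = S.src (ev S.toPreSgpd C.lab rest) := by
      rw [← hm1, hs2, S.tgt_mul _ _ hs1]
    refine ⟨lam, i, S.mul s (ev S.toPreSgpd C.lab rest), ?_, ?_⟩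
    · rw [S.src_mul _ _ h1, ← hs1, R.P_tgt]
    · rw [hs2, S.mul_assoc' _ _ _ hs1 h1]

/-- Right multiplication by a fixed arrow is a relation with finitely many residuals. -/
def relArrow {O A X : Type} [Nonempty A] (S : Sgpd O A) (C : ChoiceOfReps S.toPreSgpd X) (s : A) :
    Set (List X × List X) :=
  { p | p.1 ∈ C.K ∧ p.2 ∈ C.K ∧ S.tgt (ev S.toPreSgpd C.lab p.1) = S.src s ∧
    S.mul (ev S.toPreSgpd C.lab p.1) s = ev S.toPreSgpd C.lab p.2 }

theorem relEdge_eq {O A X : Type} [Nonempty A] (S : Sgpd O A) (C : ChoiceOfReps S.toPreSgpd X)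
    (e : X) : relEdge C e = relArrow S C (C.lab e) := by
  ext ⟨u, v⟩
  simp only [relEdge, relArrow, Set.mem_ofPred_eq]
  refine and_congr_right fun hu => and_congr_right fun hv => ?_
  obtain ⟨hu1, hu2⟩ := C.K_path u hu
  obtain ⟨hv1, hv2⟩ := C.K_path v hv
  rw [evalPath?_eq _ _ (by simp), evalPath?_eq _ _ hv1, ev_append _ _ hu1]
  simp only [pathTgt?, List.getLast?_eq_getLast_of_ne_nil hu1, Option.map_some, Option.some.injEq, List.map_cons,
    List.map_nil, List.foldl_cons, List.foldl_nil]
  rw [ev_tgt S C hu2 (u.getLast hu1) (by simp [List.getLast?_eq_getLast_of_ne_nil hu1]), C.lab_src]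

theorem finRes_relArrow {O A X : Type} [Nonempty A] (S : Sgpd O A)
    (C : ChoiceOfReps S.toPreSgpd X) (h : IsAutomaticStructure C) (s : A) :
    FinRes (relArrow S C s) := by
  obtain ⟨hfin, -, hE, -⟩ := h
  have key : ∀ l : List X, l ≠ [] → IsPathChain C.esrc C.etgt l →
      FinRes (relArrow S C (ev S.toPreSgpd C.lab l)) := by
    intro l
    induction l with
    | nil => intro h; exact absurd rfl h
    | cons e l ih =>
      intro _ hp
      have hbase : FinRes (relArrow S C (C.lab e)) := by
        rw [← relEdge_eq]; exact (hE e).finRes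
      by_cases hl : l = []
      · subst hl; exact hbase
      · have hp' : IsPathChain C.esrc C.etgt ([e] ++ l) := hp
        obtain ⟨hm1, hm2⟩ := ev_mul S C hp' (by simp) hl
        have he1 : ev S.toPreSgpd C.lab [e] = C.lab e := rfl
        rw [he1] at hm1 hm2
        have hrec := ih hl (chain_append.1 hp').2.1
        have := finRes_comp hbase hrec
        convert this using 1
        rw [show e :: l = [e] ++ l from rfl, hm2]
        ext ⟨u, v⟩
        simp only [relArrow, Set.mem_ofPred_eq]
        constructor
        · rintro ⟨hu, hv, h1, h2⟩
          rw [S.src_mul _ _ hm1] at h1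
          obtain ⟨w, hw, hwe⟩ := C.K_onto (S.mul (ev S.toPreSgpd C.lab u) (C.lab e))
          rw [evalPath?_eq _ _ (C.K_path w hw).1, Option.some.injEq] at hwe
          refine ⟨w, ⟨hu, hw, h1, hwe.symm⟩, hw, hv, ?_, ?_⟩
          · rw [hwe, S.tgt_mul _ _ h1, hm1]
          · rw [hwe, S.mul_assoc' _ _ _ h1 hm1, h2]
        · rintro ⟨w, ⟨hu, hw, h1, hwe⟩, -, hv, h2, h3⟩
          refine ⟨hu, hv, ?_, ?_⟩
          · rw [S.src_mul _ _ hm1, h1]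
          · rw [← S.mul_assoc' _ _ _ h1 hm1, hwe, h3]
  obtain ⟨l, hl, he⟩ := C.K_onto s
  obtain ⟨h1, h2⟩ := C.K_path l hl
  rw [evalPath?_eq _ _ h1, Option.some.injEq] at he
  rw [← he]
  exact key l h1 h2

/-- Finite generation forces the index sets to be finite. -/
theorem finite_index {O A I Λ : Type} (S : Sgpd O A) (R : Rees.Data S I Λ)
    (hfg : IsFG (Rees.pre S R)) : Finite I ∧ Finite Λ := by
  obtain ⟨T, hT, hgen⟩ := hfg
  have h1 : ∀ (l : List (Rees.Carrier S R)) (m : Rees.Carrier S R),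
      (l.foldl (Rees.mul S R) m).1.1 = m.1.1 := by
    intro l
    induction l with
    | nil => intro m; rfl
    | cons x l ih => intro m; rw [List.foldl_cons, ih]; rfl
  have h2 : ∀ (l : List (Rees.Carrier S R)) (m : Rees.Carrier S R),
      ∃ x ∈ m :: l, (l.foldl (Rees.mul S R) m).1.2.2 = x.1.2.2 := by
    intro l
    induction l with
    | nil => intro m; exact ⟨m, by simp, rfl⟩
    | cons x l ih =>
      intro m
      obtain ⟨y, hy, hye⟩ := ih (Rees.mul S R m x)
      rcases List.mem_cons.1 hy with rfl | hy
      · exact ⟨x, by simp, hye⟩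
      · exact ⟨y, by simp [hy], hye⟩
  have h3 : ∀ m : Rees.Carrier S R, (∃ x ∈ T, x.1.1 = m.1.1) ∧ (∃ x ∈ T, x.1.2.2 = m.1.2.2) := by
    intro m
    obtain ⟨l, hl, hlT, -, he⟩ := hgen m
    cases l with
    | nil => exact absurd rfl hl
    | cons x l =>
      simp only [evalPath?, List.map_id, id, Option.some.injEq] at he
      have he' : l.foldl (Rees.mul S R) x = m := by
        rw [← he]; rfl
      constructor
      · exact ⟨x, hlT x (by simp), by rw [← he', h1]⟩
      · obtain ⟨y, hy, hye⟩ := h2 l x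
        exact ⟨y, hlT y hy, by rw [← he', hye]⟩
  constructor
  · have : (Set.univ : Set I).Finite := by
      refine (hT.image (fun m : Rees.Carrier S R => m.1.1)).subset ?_
      intro i _
      obtain ⟨a, ha⟩ := R.F_into i
      obtain ⟨lam, hlam⟩ := R.G_onto a
      obtain ⟨x, hx, hxe⟩ := (h3 ⟨(i, a, lam), ha.symm, hlam.symm⟩).1
      exact ⟨x, hx, hxe⟩
    exact Set.finite_univ_iff.1 this
  · have : (Set.univ : Set Λ).Finite := by
      refine (hT.image (fun m : Rees.Carrier S R => m.1.2.2)).subset ?_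
      intro lam _
      obtain ⟨a, ha⟩ := R.G_into lam
      obtain ⟨i, hi⟩ := R.F_onto a
      obtain ⟨x, hx, hxe⟩ := (h3 ⟨(i, a, lam), hi, ha⟩).2
      exact ⟨x, hx, hxe⟩
    exact Set.finite_univ_iff.1 this

end Paths

/-! ## The new alphabet and language -/

section Letters

/-- Factorisation of the value of the block of a letter. The component `k = none` marks an
initial letter, `k = some lam` a letter which absorbs a matrix entry from row `lam`. -/
def Fact {O A I Λ : Type} (S : Sgpd O A) (R : Rees.Data S I Λ) (k : Option Λ) (i : I)
    (x s : A) : Prop :=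
  R.F i = S.src s ∧ ((k = none ∧ x = s) ∨ ∃ lam, k = some lam ∧ x = S.mul (R.P lam i) s)

/-- Validity of letters `(k, i, b, mu)`, where `b` is a short path. -/
def LetterOK {O A I Λ X : Type} [Nonempty A] (S : Sgpd O A) (R : Rees.Data S I Λ)
    (C : ChoiceOfReps S.toPreSgpd X) (D : ℕ) (y : Option Λ × I × List X × Λ) : Prop :=
  y.2.2.1 ≠ [] ∧ y.2.2.1.length < 2 * D ∧ IsPathChain C.esrc C.etgt y.2.2.1 ∧
    ∃ s, Fact S R y.1 y.2.1 (ev S.toPreSgpd C.lab y.2.2.1) s ∧ S.tgt s = R.G y.2.2.2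

/-- The new alphabet. -/
def Letter {O A I Λ X : Type} [Nonempty A] (S : Sgpd O A) (R : Rees.Data S I Λ)
    (C : ChoiceOfReps S.toPreSgpd X) (D : ℕ) : Type :=
  { y : Option Λ × I × List X × Λ // LetterOK S R C D y }

variable {O A I Λ X : Type} [Nonempty A] {S : Sgpd O A} {R : Rees.Data S I Λ}
  {C : ChoiceOfReps S.toPreSgpd X} {D : ℕ}

theorem finite_letter [Finite I] [Finite Λ] [Finite X] : Finite (Letter S R C D) := by
  have h : (Set.univ ×ˢ Set.univ ×ˢ { l : List X | l.length ≤ 2 * D } ×ˢ Set.univ :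
      Set (Option Λ × I × List X × Λ)).Finite :=
    Set.finite_univ.prod (Set.finite_univ.prod
      ((List.finite_length_le X (2 * D)).prod Set.finite_univ))
  have h2 : { y : Option Λ × I × List X × Λ | LetterOK S R C D y }.Finite := by
    refine h.subset ?_
    intro y hy
    exact ⟨trivial, trivial, le_of_lt hy.2.1, trivial⟩
  exact h2.to_subtype

/-- The block of a letter. -/
def Letter.blk (y : Letter S R C D) : List X := y.1.2.2.1

/-- The row absorbed by a letter. -/
def Letter.row (y : Letter S R C D) : Option Λ := y.1.1

/-- First index of a letter. -/
def Letter.ix (y : Letter S R C D) : I := y.1.2.1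

/-- Last index of a letter. -/
def Letter.mu (y : Letter S R C D) : Λ := y.1.2.2.2

theorem Letter.spec (y : Letter S R C D) : y.blk ≠ [] ∧ y.blk.length < 2 * D ∧
    IsPathChain C.esrc C.etgt y.blk ∧
    ∃ s, Fact S R y.row y.ix (ev S.toPreSgpd C.lab y.blk) s ∧ S.tgt s = R.G y.mu := y.2

/-- The middle component of the value of a letter. -/
noncomputable def Letter.mid (y : Letter S R C D) : A := Classical.choose y.spec.2.2.2

theorem Letter.mid_spec (y : Letter S R C D) :
    Fact S R y.row y.ix (ev S.toPreSgpd C.lab y.blk) y.mid ∧ S.tgt y.mid = R.G y.mu :=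
  Classical.choose_spec y.spec.2.2.2

/-- The value of a letter in the Rees matrix semigroup. -/
noncomputable def Letter.val (y : Letter S R C D) : Rees.Carrier S R :=
  ⟨(y.ix, y.mid, y.mu), y.mid_spec.1.1, y.mid_spec.2⟩

/-- Decoding. -/
def dec (w : List (Letter S R C D)) : List X := w.flatMap Letter.blk

theorem dec_append (a b : List (Letter S R C D)) : dec (a ++ b) = dec a ++ dec b := by
  simp [dec]

theorem dec_cons (y : Letter S R C D) (b : List (Letter S R C D)) :
    dec (y :: b) = y.blk ++ dec b := by
  simp [dec]

/-- Allowed consecutive letters. -/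
def nxt (y y' : Letter S R C D) : Prop :=
  y.blk.length = D ∧ D ≤ y'.blk.length ∧ y'.row = some y.mu

/-- Words of letters encoding paths. -/
def Enc (S : Sgpd O A) (R : Rees.Data S I Λ) (C : ChoiceOfReps S.toPreSgpd X) (D : ℕ) :
    Set (List (Letter S R C D)) :=
  { w | (∃ y t, w = y :: t ∧ y.row = none) ∧ List.IsChain nxt w }

theorem len_upper (hD : 0 < D) (w : List (Letter S R C D)) (h : List.IsChain nxt w) :
    (dec w).length < (w.length + 1) * D := by
  induction w with
  | nil => simpa [dec] using hD
  | cons y w ih =>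
    cases w with
    | nil =>
      have := y.spec.2.1
      have hd : dec [y] = y.blk := by simp [dec]
      rw [hd]
      simp only [List.length_cons, List.length_nil]
      linarith
    | cons y' w =>
      rw [List.isChain_cons_cons] at h
      have h1 := ih h.2
      have h2 := h.1.1
      rw [dec_cons, List.length_append, h2, List.length_cons]
      linarith [h1]

theorem len_lower (w : List (Letter S R C D)) (h : List.IsChain nxt w) (h1 : w.length ≠ 1) :
    w.length * D ≤ (dec w).length := by
  induction w with
  | nil => simp
  | cons y w ih =>
    cases w with
    | nil => simp at h1
    | cons y' w =>
      rw [List.isChain_cons_cons] at h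
      have h2 := h.1.1
      have h3 := h.1.2.1
      rw [dec_cons, List.length_append, h2, List.length_cons]
      have key : (y' :: w).length * D ≤ (dec (y' :: w)).length := by
        by_cases hw : (y' :: w).length = 1
        · rw [hw, dec_cons, List.length_append]; omega
        · exact ih h.2 hw
      linarith

theorem len_lt (hD : 0 < D) {a b : List (Letter S R C D)} (ha : List.IsChain nxt a)
    (hb : List.IsChain nxt b) (h : a.length < b.length) :
    (dec a).length ≤ (dec b).length := by
  by_cases hb1 : b.length = 1
  · have : a = [] := List.length_eq_zero_iff.1 (by omega)
    subst this
    simp [dec]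
  · have h1 := len_upper hD a ha
    have h2 := len_lower b hb hb1
    have h3 : (a.length + 1) * D ≤ b.length * D := Nat.mul_le_mul_right _ h
    omega

theorem len_near (hD : 0 < D) {a b : List (Letter S R C D)} (ha : List.IsChain nxt a)
    (hb : List.IsChain nxt b) (h : a.length = b.length) :
    (dec a).length ≤ (dec b).length + 2 * D := by
  have h1 := len_upper hD a ha
  by_cases hb1 : b.length = 1
  · rw [h, hb1] at h1
    omega
  · have h2 := len_lower b hb hb1
    rw [h] at h1
    have : (b.length + 1) * D = b.length * D + D := by ring
    omega

/-- Pulling back a relation along decoding. -/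
theorem finRes_pull [Finite I] [Finite Λ] [Finite X] (hD : 0 < D)
    {L₁ L₂ : Set (List (Letter S R C D))} (hL₁ : IsRegularSet L₁) (hL₂ : IsRegularSet L₂)
    (hc₁ : ∀ w ∈ L₁, List.IsChain nxt w) (hc₂ : ∀ w ∈ L₂, List.IsChain nxt w)
    (h : Option (Letter S R C D) → Option (Letter S R C D) → Option (Letter S R C D) →
      Option (Letter S R C D) → Prop)
    {Q : Set (List X × List X)} (hQ : FinRes Q) :
    FinRes { p : List (Letter S R C D) × List (Letter S R C D) | p.1 ∈ L₁ ∧ p.2 ∈ L₂ ∧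
      h p.1.head? p.1.getLast? p.2.head? p.2.getLast? ∧ (dec p.1, dec p.2) ∈ Q } := by
  have hfL := finite_letter (S := S) (R := R) (C := C) (D := D)
  rw [regular_iff_lq] at hL₁ hL₂
  have hnear := finite_near hQ (2 * D)
  let W := List (Letter S R C D) × List (Letter S R C D)
  have f1 := finite_range_comp (fun p : W => p.1) hL₁
  have f2 := finite_range_comp (fun p : W => p.2) hL₂
  have f3 := finite_range_comp (fun p : W => (dec p.1, dec p.2)) hnear
  have f4 := finite_range_comp (fun p : W => (dec p.1, dec p.2)) hQ
  have f5 := finite_range_prop fun p : W => p.1.length < p.2.length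
  have f6 := finite_range_prop fun p : W => p.2.length < p.1.length
  have f7 : (Set.range fun p : W => ((p.1.head?, p.1.getLast?), (p.2.head?, p.2.getLast?))).Finite :=
    Set.toFinite _
  refine finRes_of_factor (finite_range_prod f1 (finite_range_prod f2 (finite_range_prod f3
    (finite_range_prod f4 (finite_range_prod f5 (finite_range_prod f6 f7)))))) ?_
  rintro ⟨a, b⟩ ⟨a', b'⟩ hpp ⟨c, d⟩ ⟨⟨m1, m2, m3, m4⟩, hc⟩
  simp only [Prod.mk.injEq] at hpp
  obtain ⟨e1, e2, e3, e4, e5, e6, ⟨e7, e8⟩, e9, e10⟩ := hpp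
  simp only at m1 m2 m3 m4
  have hc' : Compat (a', b') (c, d) :=
    ⟨fun hl => hc.1 (by simp only at hl ⊢; rw [e5]; exact hl),
     fun hl => hc.2 (by simp only at hl ⊢; rw [e6]; exact hl)⟩
  have n1 : c ∈ lq L₁ a' := by rw [← e1]; exact m1
  have n2 : d ∈ lq L₂ b' := by rw [← e2]; exact m2
  refine ⟨⟨n1, n2, ?_, ?_⟩, hc'⟩
  · simp only [List.head?_append, List.getLast?_append] at m3 ⊢
    rw [← e7, ← e8, ← e9, ← e10]
    exact m3
  · have ca : List.IsChain nxt a := (List.isChain_append.1 (hc₁ _ m1)).1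
    have cb : List.IsChain nxt b := (List.isChain_append.1 (hc₂ _ m2)).1
    simp only [dec_append] at m4 ⊢
    rcases lt_trichotomy a.length b.length with hl | hl | hl
    · have hcn : c = [] := hc.1 hl
      have hle := len_lt hD ca cb hl
      have hm : (dec c, dec d) ∈ res Q (dec a, dec b) := by
        refine ⟨m4, fun _ => by simp [hcn, dec], fun hlt => ?_⟩
        simp only at hlt
        omega
      rw [e4] at hm
      exact hm.1
    · have hm : (dec c, dec d) ∈ { q : List X × List X |
          (dec a).length ≤ (dec b).length + 2 * D ∧ (dec b).length ≤ (dec a).length + 2 * D ∧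
          (dec a ++ q.1, dec b ++ q.2) ∈ Q } :=
        ⟨len_near hD ca cb hl, len_near hD cb ca hl.symm, m4⟩
      rw [e3] at hm
      exact hm.2.2
    · have hcn : d = [] := hc.2 hl
      have hle := len_lt hD cb ca hl
      have hm : (dec c, dec d) ∈ res Q (dec a, dec b) := by
        refine ⟨m4, fun hlt => ?_, fun _ => by simp [hcn, dec]⟩
        simp only at hlt
        omega
      rw [e4] at hm
      exact hm.1

/-- The new language. -/
def Lang (S : Sgpd O A) (R : Rees.Data S I Λ) (C : ChoiceOfReps S.toPreSgpd X) (D : ℕ) :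
    Set (List (Letter S R C D)) := { w | w ∈ Enc S R C D ∧ dec w ∈ C.K }

theorem regular_lang [Finite I] [Finite Λ] [Finite X] (hK : IsRegularSet C.K) :
    IsRegularSet (Lang S R C D) := by
  have hfL := finite_letter (S := S) (R := R) (C := C) (D := D)
  rw [regular_iff_lq] at hK ⊢
  let W := List (Letter S R C D)
  have f1 := finite_range_comp (fun a : W => dec a) hK
  have f2 := finite_range_prop fun a : W => List.IsChain nxt a
  have f3 : (Set.range fun a : W => (a.head?, a.getLast?)).Finite := Set.toFinite _
  have hhead : ∀ w : W, (∃ y t, w = y :: t ∧ y.row = none) ↔ ∃ y, w.head? = some y ∧ y.row = none := by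
    intro w
    cases w with
    | nil => simp
    | cons y t =>
      constructor
      · rintro ⟨y', t', he, hr⟩
        obtain ⟨rfl, rfl⟩ := List.cons.inj he
        exact ⟨y, rfl, hr⟩
      · rintro ⟨y', he, hr⟩
        obtain rfl : y = y' := by simpa using he
        exact ⟨y, t, rfl, hr⟩
  have hsub : ∀ a a' : W, ((lq C.K (dec a), List.IsChain nxt a, (a.head?, a.getLast?)) :
        Set (List X) × Prop × _ × _) =
      (lq C.K (dec a'), List.IsChain nxt a', (a'.head?, a'.getLast?)) →
      lq (Lang S R C D) a ⊆ lq (Lang S R C D) a' := by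
    intro a a' hpp z hz
    simp only [Prod.mk.injEq] at hpp
    obtain ⟨e1, e2, e3, e4⟩ := hpp
    obtain ⟨⟨h1, h2⟩, h3⟩ := hz
    refine ⟨⟨?_, ?_⟩, ?_⟩
    · rw [hhead] at h1 ⊢
      rw [List.head?_append] at h1 ⊢
      rw [← e3]; exact h1
    · rw [List.isChain_append] at h2 ⊢
      rw [← e2, ← e4]; exact h2
    · rw [dec_append] at h3 ⊢
      have : dec z ∈ lq C.K (dec a) := h3
      rw [e1] at this
      exact this
  exact finite_range_of_factor (finite_range_prod f1 (finite_range_prod f2 f3))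
    fun a a' hpp => Set.Subset.antisymm (hsub a a' hpp) (hsub a' a hpp.symm)

theorem regular_prefs {Y : Type} {L : Set (List Y)} (hL : IsRegularSet L) :
    IsRegularSet (prefs L) := by
  rw [regular_iff_lq] at hL ⊢
  have hsub : ∀ a a' : List Y, ((lq L a, a = []) : Set (List Y) × Prop) = (lq L a', a' = []) →
      lq (prefs L) a ⊆ lq (prefs L) a' := by
    intro a a' hpp z hz
    simp only [Prod.mk.injEq] at hpp
    obtain ⟨e1, e2⟩ := hpp
    obtain ⟨h1, l, hl, t, rfl⟩ := hz
    refine ⟨?_, ?_⟩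
    · simp only [ne_eq, List.append_eq_nil_iff] at h1 ⊢
      rw [← e2]; exact h1
    · have : z ++ t ∈ lq L a := by
        show a ++ (z ++ t) ∈ L
        rw [← List.append_assoc]; exact hl
      rw [e1] at this
      refine ⟨a' ++ (z ++ t), this, t, by simp⟩
  exact finite_range_of_factor (finite_range_prod hL (finite_range_prop fun a : List Y => a = []))
    fun a a' hpp => Set.Subset.antisymm (hsub a a' hpp) (hsub a' a hpp.symm)

/-- Evaluating an encoded tail in the Rees matrix semigroup. -/
theorem eval_fold (w : List (Letter S R C D)) : ∀ m : Rees.Carrier S R,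
    List.IsChain nxt w → (∀ y ∈ w.head?, y.row = some m.1.2.2) →
    ((w.map Letter.val).foldl (Rees.mul S R) m).1 =
      (m.1.1, ((dec w).map C.lab).foldl S.mul m.1.2.1, (w.getLast?.map Letter.mu).getD m.1.2.2) := by
  induction w with
  | nil => intro m _ _; rfl
  | cons y w ih =>
    intro m hch hh
    have hrow := hh y (by simp)
    rw [List.map_cons, List.foldl_cons]
    have hv : (Rees.mul S R m y.val).1 =
        (m.1.1, S.mul (S.mul m.1.2.1 (R.P m.1.2.2 y.ix)) y.mid, y.mu) := rfl
    rw [ih _ hch.tail ?_, hv]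
    · have hmP : S.tgt m.1.2.1 = S.src (R.P m.1.2.2 y.ix) := by
        rw [R.P_src]; exact m.2.2
      obtain ⟨⟨hF, hx⟩, hG⟩ := y.mid_spec
      have hPs : S.tgt (R.P m.1.2.2 y.ix) = S.src y.mid := by rw [R.P_tgt, hF]
      have hev : ev S.toPreSgpd C.lab y.blk = S.mul (R.P m.1.2.2 y.ix) y.mid := by
        rcases hx with ⟨h0, -⟩ | ⟨lam, h0, hx⟩
        · rw [hrow] at h0; exact absurd h0 (by simp)
        · rw [hrow, Option.some.injEq] at h0
          rw [hx, h0]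
      have hfold : (y.blk.map C.lab).foldl S.mul m.1.2.1 =
          S.mul (S.mul m.1.2.1 (R.P m.1.2.2 y.ix)) y.mid := by
        rw [fold_eq_mul S C y.spec.2.2.1 y.spec.1, hev, S.mul_assoc' _ _ _ hmP hPs]
        rw [hev, S.src_mul _ _ hPs, hmP]
      rw [dec_cons, List.map_append, List.foldl_append, hfold]
      cases w with
      | nil => rfl
      | cons y' w =>
        rw [List.getLast?_cons_cons]
        simp [List.getLast?_eq_getLast_of_ne_nil]
    · intro y' hy'
      cases w with
      | nil => simp at hy'
      | cons z w =>
        obtain rfl : z = y' := by simpa using hy'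
        exact (List.isChain_cons_cons.1 hch).1.2.2

/-- Evaluation of an encoded word. -/
theorem eval_enc {y : Letter S R C D} {t : List (Letter S R C D)} (h : y :: t ∈ Enc S R C D) :
    ∃ m : Rees.Carrier S R, evalPath? (Rees.pre S R) Letter.val (y :: t) = some m ∧
      m.1 = (y.ix, ev S.toPreSgpd C.lab (dec (y :: t)), ((y :: t).getLast (by simp)).mu) := by
  obtain ⟨⟨y', t', he, hr⟩, hch⟩ := h
  obtain ⟨rfl, rfl⟩ := List.cons.inj he
  refine ⟨_, rfl, ?_⟩
  have hmid : ev S.toPreSgpd C.lab y.blk = y.mid := by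
    rcases y.mid_spec.1.2 with ⟨-, hx⟩ | ⟨lam, h0, -⟩
    · exact hx
    · rw [hr] at h0; exact absurd h0 (by simp)
  have := eval_fold t y.val hch.tail (by
    intro z hz
    cases t with
    | nil => simp at hz
    | cons z' t =>
      obtain rfl : z' = z := by simpa using hz
      exact (List.isChain_cons_cons.1 hch).1.2.2)
  refine Eq.trans this ?_
  have hv : y.val.1 = (y.ix, y.mid, y.mu) := rfl
  rw [dec_cons, ev_append _ _ y.spec.1, hmid, hv]
  cases t with
  | nil => rfl
  | cons z t => simp [List.getLast?_eq_getLast_of_ne_nil]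

/-- Encoding of paths with good factors. -/
theorem exists_encoding (hD : 0 < D) : ∀ (n : ℕ) (u : List X), u.length ≤ n → u ≠ [] →
    IsPathChain C.esrc C.etgt u →
    (∀ f, f <:+: u → D ≤ f.length → GoodArrow S R (ev S.toPreSgpd C.lab f)) →
    ∀ mu, R.G mu = S.tgt (ev S.toPreSgpd C.lab u) → ∀ o : Option I,
    (∀ i, o = some i → R.F i = S.src (ev S.toPreSgpd C.lab u)) → (o = none → D ≤ u.length) →
    ∃ (y : Letter S R C D) (t : List (Letter S R C D)), List.IsChain nxt (y :: t) ∧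
      dec (y :: t) = u ∧ ((y :: t).getLast (by simp)).mu = mu ∧
      (∀ i, o = some i → y.row = none ∧ y.ix = i) ∧
      (o = none → D ≤ y.blk.length ∧
        ∃ lam, y.row = some lam ∧ R.G lam = S.src (ev S.toPreSgpd C.lab u)) := by
  intro n
  induction n with
  | zero =>
    intro u hu hne
    exact absurd (List.length_eq_zero_iff.1 (by omega)) hne
  | succ n ih =>
    intro u hu hne hpath hgood mu hmu o ho1 ho2
    -- building a letter on a prefix block
    have mk : ∀ b r : List X, u = b ++ r → b ≠ [] → b.length < 2 * D → (o = none → D ≤ b.length) →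
        ∀ nu, R.G nu = S.tgt (ev S.toPreSgpd C.lab b) →
        ∃ y : Letter S R C D, y.blk = b ∧ y.mu = nu ∧
          (∀ i, o = some i → y.row = none ∧ y.ix = i) ∧
          (o = none → ∃ lam, y.row = some lam ∧ R.G lam = S.src (ev S.toPreSgpd C.lab u)) := by
      intro b r hub hb hbl hob nu hnu
      have hbp : IsPathChain C.esrc C.etgt b := by
        rw [hub] at hpath; exact (chain_append.1 hpath).1
      have hsrc : S.src (ev S.toPreSgpd C.lab b) = S.src (ev S.toPreSgpd C.lab u) := by
        cases b with
        | nil => exact absurd rfl hb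
        | cons e b =>
          rw [ev_src S C hbp, hub]
          rw [hub] at hpath
          exact (ev_src S C hpath).symm
      cases o with
      | some i =>
        refine ⟨⟨(none, i, b, nu), hb, hbl, hbp, ev S.toPreSgpd C.lab b, ⟨?_, ?_⟩, hnu.symm⟩,
          rfl, rfl, ?_, by simp⟩
        · rw [hsrc]; exact ho1 i rfl
        · left; exact ⟨rfl, rfl⟩
        · intro j hj
          exact ⟨rfl, Option.some.inj hj⟩
      | none =>
        obtain ⟨lam, i, s, hF, hs⟩ := hgood b ⟨[], r, by simp [hub]⟩ (hob rfl)
        have hPs : S.tgt (R.P lam i) = S.src s := by rw [R.P_tgt, hF]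
        refine ⟨⟨(some lam, i, b, nu), hb, hbl, hbp, s, ⟨hF, ?_⟩, ?_⟩, rfl, rfl, by simp, ?_⟩
        · right; exact ⟨lam, rfl, hs⟩
        · rw [hnu]; simp only [hs]; rw [S.tgt_mul _ _ hPs]
        · intro _
          refine ⟨lam, rfl, ?_⟩
          rw [← hsrc, hs, S.src_mul _ _ hPs, R.P_src]
    by_cases hlen : u.length < 2 * D
    · obtain ⟨y, h1, h2, h3, h4⟩ := mk u [] (by simp) hne hlen ho2 mu hmu
      refine ⟨y, [], List.isChain_singleton _, ?_, ?_, h3, ?_⟩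
      · simp [dec, h1]
      · simpa using h2
      · intro h; rw [h1]; exact ⟨ho2 h, h4 h⟩
    · have hsp : u = u.take D ++ u.drop D := (List.take_append_drop D u).symm
      have hb : u.take D ≠ [] := by
        intro h0
        have := congrArg List.length h0
        simp only [List.length_take, List.length_nil] at this
        omega
      have hr : u.drop D ≠ [] := by
        intro h0
        have := congrArg List.length h0
        simp only [List.length_drop, List.length_nil] at this
        omega
      have hbl : (u.take D).length = D := by rw [List.length_take]; omega
      have hpath' := hpath
      rw [hsp] at hpath'
      obtain ⟨hm1, hm2⟩ := ev_mul S C hpath' hb hr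
      rw [← hsp] at hm2
      obtain ⟨y', t', c1, c2, c3, -, c5⟩ := ih (u.drop D) (by rw [List.length_drop]; omega) hr
        (chain_append.1 hpath').2.1
        (fun f hf hfl => hgood f (hf.trans (List.drop_suffix D u).isInfix) hfl)
        mu (by rw [hmu, hm2, S.tgt_mul _ _ hm1]) none (by simp)
        (by intro _; rw [List.length_drop]; omega)
      obtain ⟨c6, lam, c7, c8⟩ := c5 rfl
      obtain ⟨y, h1, h2, h3, h4⟩ := mk (u.take D) (u.drop D) hsp hb (by omega) (by intro _; omega)
        lam (by rw [c8, hm1])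
      refine ⟨y, y' :: t', ?_, ?_, ?_, h3, ?_⟩
      · rw [List.isChain_cons_cons]
        exact ⟨⟨by rw [h1, hbl], c6, by rw [c7, h2]⟩, c1⟩
      · rw [dec_cons, c2, h1, List.take_append_drop]
      · simpa using c3
      · intro h; rw [h1]; exact ⟨by omega, h4 h⟩

end Letters

/-! ## The automatic structure of the Rees matrix semigroup -/

section Final

variable {O A I Λ X : Type} [Nonempty A] {S : Sgpd O A} {R : Rees.Data S I Λ}
  {C : ChoiceOfReps S.toPreSgpd X} {D : ℕ}

theorem enc_facts {w : List (Letter S R C D)} (h : w ∈ Enc S R C D) :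
    ∃ m : Rees.Carrier S R, evalPath? (Rees.pre S R) Letter.val w = some m ∧
      w.head?.map Letter.ix = some m.1.1 ∧ ev S.toPreSgpd C.lab (dec w) = m.1.2.1 ∧
      w.getLast?.map Letter.mu = some m.1.2.2 ∧ dec w ≠ [] ∧ w ≠ [] := by
  obtain ⟨y, t, rfl, -⟩ := h.1
  obtain ⟨m, h1, h2⟩ := eval_enc h
  refine ⟨m, h1, ?_, ?_, ?_, ?_, by simp⟩
  · rw [h2]; rfl
  · rw [h2]
  · rw [h2, List.getLast?_eq_getLast_of_ne_nil (by simp)]; rfl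
  · rw [dec_cons]
    intro h0
    exact y.spec.1 (List.append_eq_nil_iff.1 h0).1

theorem carrier_ext {m n : Rees.Carrier S R} (h1 : m.1.1 = n.1.1) (h2 : m.1.2.1 = n.1.2.1)
    (h3 : m.1.2.2 = n.1.2.2) : m = n :=
  Subtype.ext (Prod.ext h1 (Prod.ext h2 h3))

theorem enc_prefix {w p : List (Letter S R C D)} (h : w ∈ Enc S R C D) (hp : p <+: w)
    (hne : p ≠ []) : p ∈ Enc S R C D := by
  obtain ⟨r, rfl⟩ := hp
  obtain ⟨⟨y, t, he, hr⟩, hch⟩ := h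
  refine ⟨?_, (List.isChain_append.1 hch).1⟩
  cases p with
  | nil => exact absurd rfl hne
  | cons z p =>
    obtain ⟨rfl, -⟩ := List.cons.inj he
    exact ⟨z, p, rfl, hr⟩

theorem prefs_enc {p : List (Letter S R C D)} (h : p ∈ prefs (Lang S R C D)) :
    p ∈ Enc S R C D ∧ dec p ∈ prefs C.K := by
  obtain ⟨hne, w, hw, hpw⟩ := h
  have hp := enc_prefix hw.1 hpw hne
  obtain ⟨m, -, -, -, -, hd, -⟩ := enc_facts hp
  refine ⟨hp, hd, dec w, hw.2, ?_⟩
  obtain ⟨r, rfl⟩ := hpw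
  rw [dec_append]
  exact List.prefix_append _ _

theorem lang_prefs {p : List (Letter S R C D)} (h : p ∈ Lang S R C D) :
    p ∈ prefs (Lang S R C D) := by
  obtain ⟨m, -, -, -, -, -, hne⟩ := enc_facts h.1
  exact ⟨hne, p, h, List.prefix_refl p⟩

theorem isPathChain_unit {Y : Type} (f g : Y → Unit) (l : List Y) : IsPathChain f g l := by
  induction l with
  | nil => exact List.isChain_nil
  | cons a l ih =>
    cases l with
    | nil => exact List.isChain_singleton _
    | cons b l => exact List.isChain_cons_cons.2 ⟨rfl, ih⟩

/-- The choice of representatives for the Rees matrix semigroup. -/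
noncomputable def reesReps (S : Sgpd O A) (R : Rees.Data S I Λ) (C : ChoiceOfReps S.toPreSgpd X)
    (D : ℕ) (hD : 0 < D)
    (hgood : ∀ a : A, ∃ u ∈ C.K, ev S.toPreSgpd C.lab u = a ∧
      ∀ f, f <:+: u → D ≤ f.length → GoodArrow S R (ev S.toPreSgpd C.lab f)) :
    ChoiceOfReps (Rees.pre S R) (Letter S R C D) where
  esrc _ := ()
  etgt _ := ()
  lab := Letter.val
  lab_src _ := rfl
  lab_tgt _ := rfl
  K := Lang S R C D
  K_path := by
    intro l hl
    obtain ⟨m, -, -, -, -, -, hne⟩ := enc_facts hl.1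
    exact ⟨hne, isPathChain_unit _ _ _⟩
  K_onto := by
    intro m
    obtain ⟨u, hu, hev, hg⟩ := hgood m.1.2.1
    obtain ⟨hu1, hu2⟩ := C.K_path u hu
    obtain ⟨y, t, h1, h2, h3, h4, -⟩ := exists_encoding (S := S) (R := R) (C := C) hD u.length u
      le_rfl hu1 hu2 hg m.1.2.2 (by rw [hev]; exact m.2.2.symm) (some m.1.1)
      (by intro i hi; rw [hev, ← Option.some.inj hi]; exact m.2.1) (by simp)
    obtain ⟨h5, h6⟩ := h4 _ rfl
    have henc : y :: t ∈ Enc S R C D := ⟨⟨y, t, rfl, h5⟩, h1⟩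
    refine ⟨y :: t, ⟨henc, by rw [h2]; exact hu⟩, ?_⟩
    obtain ⟨n, hn, hn2⟩ := eval_enc henc
    rw [hn, Option.some.injEq]
    apply Subtype.ext
    rw [hn2, h2, hev, h3, h6]

theorem eval_eq_iff {a b : List (Letter S R C D)} (ha : a ∈ Enc S R C D) (hb : b ∈ Enc S R C D) :
    evalPath? (Rees.pre S R) Letter.val a = evalPath? (Rees.pre S R) Letter.val b ↔
      (a.head?.map Letter.ix = b.head?.map Letter.ix ∧
        a.getLast?.map Letter.mu = b.getLast?.map Letter.mu) ∧
      evalPath? S.toPreSgpd C.lab (dec a) = evalPath? S.toPreSgpd C.lab (dec b) := by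
  obtain ⟨m, a1, a2, a3, a4, a5, -⟩ := enc_facts ha
  obtain ⟨n, b1, b2, b3, b4, b5, -⟩ := enc_facts hb
  rw [a1, b1, a2, b2, a4, b4, evalPath?_eq _ _ a5, evalPath?_eq _ _ b5, a3, b3]
  simp only [Option.some.injEq]
  constructor
  · rintro rfl; exact ⟨⟨rfl, rfl⟩, rfl⟩
  · rintro ⟨⟨h1, h2⟩, h3⟩; exact carrier_ext h1 h3 h2

theorem eval_edge_iff {a b : List (Letter S R C D)} (ha : a ∈ Lang S R C D)
    (hb : b ∈ Lang S R C D) (y : Letter S R C D) :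
    evalPath? (Rees.pre S R) Letter.val (a ++ [y]) = evalPath? (Rees.pre S R) Letter.val b ↔
      ∃ lam, (a.head?.map Letter.ix = b.head?.map Letter.ix ∧
        a.getLast?.map Letter.mu = some lam ∧ b.getLast?.map Letter.mu = some y.mu) ∧
      (dec a, dec b) ∈ relArrow S C (S.mul (R.P lam y.ix) y.mid) := by
  obtain ⟨m, a1, a2, a3, a4, a5, a6⟩ := enc_facts ha.1
  obtain ⟨n, b1, b2, b3, b4, b5, -⟩ := enc_facts hb.1
  have hap : evalPath? (Rees.pre S R) Letter.val (a ++ [y]) = some (Rees.mul S R m y.val) := by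
    cases a with
    | nil => exact absurd rfl a6
    | cons z a =>
      have : (a.map Letter.val).foldl (Rees.mul S R) z.val = m := Option.some.inj a1
      rw [← this]
      show some (((a ++ [y]).map Letter.val).foldl (Rees.mul S R) z.val) = _
      rw [List.map_append, List.foldl_append]
      rfl
  have hv : (Rees.mul S R m y.val).1 =
      (m.1.1, S.mul (S.mul m.1.2.1 (R.P m.1.2.2 y.ix)) y.mid, y.mu) := rfl
  have hmP : S.tgt m.1.2.1 = S.src (R.P m.1.2.2 y.ix) := by
    rw [R.P_src]; exact m.2.2
  have hPs : S.tgt (R.P m.1.2.2 y.ix) = S.src y.mid := by rw [R.P_tgt, y.mid_spec.1.1]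
  rw [S.mul_assoc' _ _ _ hmP hPs] at hv
  rw [hap, b1, a2, b2, a4, b4]
  simp only [Option.some.injEq, relArrow, Set.mem_ofPred_eq, a3, b3]
  constructor
  · rintro rfl
    rw [hv]
    refine ⟨m.1.2.2, ⟨rfl, rfl, rfl⟩, ha.2, hb.2, ?_, rfl⟩
    rw [S.src_mul _ _ hPs, hmP]
  · rintro ⟨lam, ⟨h1, rfl, h3⟩, -, -, -, h4⟩
    apply Subtype.ext
    rw [hv, h1, h4, ← h3]

end Final

/-- Theorem 6.3: a finitely generated Rees matrix semigroup without zero over a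
prefix-automatic semigroupoid, whose non-identity arrows are weakly
right-ideal-generated by a row cross-section of `P`, is prefix-automatic. -/
theorem stmt_17 {O A I Λ : Type} (S : Sgpd O A) (hne : Nonempty A)
    (hiso : IsolationFree S.toPreSgpd)
    (R : Rees.Data S I Λ)
    (hfg : IsFG (Rees.pre S R))
    (hS : IsPrefixAutomatic S.toPreSgpd)
    (hrig : Rees.WeaklyRIG S R { a : A | ¬ IsIdentity S.toPreSgpd a }) :
    IsPrefixAutomatic (Rees.pre S R) := by
  have hA : Nonempty A := hne
  obtain ⟨X, C, hC⟩ := hS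
  obtain ⟨hI, hΛ⟩ := finite_index S R hfg
  have hX : Finite X := hC.1.1
  obtain ⟨D, hD, hgood⟩ := exists_good S R hrig C hC.1.2.1
  have hL : Finite (Letter S R C D) := finite_letter
  have hreg : IsRegularSet (Lang S R C D) := regular_lang hC.1.2.1
  have hQ : FinRes (relPrefEq C) := hC.2.finRes
  refine ⟨Letter S R C D, reesReps S R C D hD hgood, ⟨hL, hreg, ?_, ?_⟩, ?_⟩
  · intro y
    apply FinRes.syncRegular
    have hU : FinRes (⋃ lam : Λ, { p : List (Letter S R C D) × List (Letter S R C D) |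
        p.1 ∈ Lang S R C D ∧ p.2 ∈ Lang S R C D ∧
        (p.1.head?.map Letter.ix = p.2.head?.map Letter.ix ∧
          p.1.getLast?.map Letter.mu = some lam ∧ p.2.getLast?.map Letter.mu = some y.mu) ∧
        (dec p.1, dec p.2) ∈ relArrow S C (S.mul (R.P lam y.ix) y.mid) }) :=
      finRes_iUnion fun lam => finRes_pull hD hreg hreg (fun w hw => hw.1.2)
        (fun w hw => hw.1.2)
        (fun a b c d => a.map Letter.ix = c.map Letter.ix ∧ b.map Letter.mu = some lam ∧
          d.map Letter.mu = some y.mu) (finRes_relArrow S C hC.1 _)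
    convert hU using 1
    ext ⟨a, b⟩
    simp only [Set.mem_iUnion, Set.mem_ofPred_eq]
    constructor
    · rintro ⟨h1, h2, -, h4⟩
      obtain ⟨lam, h5, h6⟩ := (eval_edge_iff h1 h2 y).1 h4
      exact ⟨lam, h1, h2, h5, h6⟩
    · rintro ⟨lam, h1, h2, h5, h6⟩
      refine ⟨h1, h2, ?_, (eval_edge_iff h1 h2 y).2 ⟨lam, h5, h6⟩⟩
      obtain ⟨m, -, -, -, -, -, h7⟩ := enc_facts h1.1
      simp only [pathTgt?, List.getLast?_eq_getLast_of_ne_nil h7]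
      rfl
  · intro v
    apply FinRes.syncRegular
    have hU := finRes_pull hD hreg hreg (fun w hw => hw.1.2) (fun w hw => hw.1.2)
      (fun a b c d => a.map Letter.ix = c.map Letter.ix ∧ b.map Letter.mu = d.map Letter.mu) hQ
    convert hU using 1
    ext ⟨a, b⟩
    constructor
    · rintro ⟨h1, h2, -, h4⟩
      obtain ⟨h5, h6⟩ := (eval_eq_iff h1.1 h2.1).1 h4
      exact ⟨h1, h2, h5, h1.2, (prefs_enc (lang_prefs h2)).2, h6⟩
    · rintro ⟨h1, h2, h5, -, -, h6⟩
      refine ⟨h1, h2, ?_, (eval_eq_iff h1.1 h2.1).2 ⟨h5, h6⟩⟩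
      obtain ⟨m, -, -, -, -, -, h7⟩ := enc_facts h1.1
      simp only [pathTgt?, List.getLast?_eq_getLast_of_ne_nil h7]
      rfl
  · apply FinRes.syncRegular
    have hU := finRes_pull hD hreg (regular_prefs hreg) (fun w hw => hw.1.2)
      (fun w hw => (prefs_enc hw).1.2)
      (fun a b c d => a.map Letter.ix = c.map Letter.ix ∧ b.map Letter.mu = d.map Letter.mu) hQ
    convert hU using 1
    ext ⟨a, b⟩
    constructor
    · rintro ⟨h1, h2, h4⟩
      obtain ⟨h5, h6⟩ := (eval_eq_iff h1.1 (prefs_enc h2).1).1 h4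
      exact ⟨h1, h2, h5, h1.2, (prefs_enc h2).2, h6⟩
    · rintro ⟨h1, h2, h5, -, -, h6⟩
      exact ⟨h1, h2, (eval_eq_iff h1.1 (prefs_enc h2).1).2 ⟨h5, h6⟩⟩

end AutoRees
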